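/- Splitting a sink of indegree 2 preserves the winner of Generalized Geography: let G = (V, A) be a finite directed graph with start vertex s, and let v ∈ V, v ≠ s, have outdegree 0 and exactly two incoming arcs (u_i, v) and (u_j, v) with u_i ≠ u_j. Let G' be obtained from G by adding a new vertex v' and replacing the arc (u_j, v) with the arc (u_j, v'). Then the first player wins Generalized Geography on (G, s) if and only if the first player wins Generalized Geography on (G', s). -/

import Mathlib

/-- `GGWins A c S` : in Generalized Geography on the directed graph with arc relation
`A`, with the token on vertex `c` and set `S` of already-visited vertices, the player
to move has a winning strategy (normal play: a player who cannot move loses). The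
player to move wins iff they can move the token along an arc to an unvisited
out-neighbor `w` such that every subsequent reply of the opponent leads to a position
where they again win (vacuously so when the opponent has no reply). -/
inductive GGWins {V : Type*} [DecidableEq V] (A : V → V → Prop) : V → Finset V → Prop
  | intro (c : V) (S : Finset V) (w : V) :
      A c w → w ∉ S →
      (∀ x : V, A w x → x ∉ insert w S → GGWins A x (insert x (insert w S))) →
      GGWins A c S

/-- The first player wins Generalized Geography on `(G, s)`: initially the token is on
the start vertex `s`, which is already marked visited. -/
def GGFirstWins {V : Type*} [DecidableEq V] (A : V → V → Prop) (s : V) : Prop :=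
  GGWins A s {s}

theorem GGWins.exists_adj {V : Type*} [DecidableEq V] {A : V → V → Prop} {c : V}
    {S : Finset V} (h : GGWins A c S) : ∃ w, A c w := by
  cases h with
  | intro _ _ w hw => exact ⟨w, hw⟩

theorem GGWins.of_adj_sink {V : Type*} [DecidableEq V] {A : V → V → Prop} {c w : V}
    {S : Finset V} (hcw : A c w) (hw : w ∉ S) (hsink : ∀ x, ¬ A w x) : GGWins A c S :=
  .intro c S w hcw hw fun x hx => absurd hx (hsink x)

/-- Away from the sink `v`, positions of the original graph and of the split graph with the
same visited vertices have the same winner. -/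
theorem ggWins_split_iff {V : Type*} [DecidableEq V]
    {A : V → V → Prop} {v uj : V}
    (hout : ∀ w : V, ¬ A v w) (hujv : A uj v)
    {A' : Option V → Option V → Prop}
    (hA' : ∀ x y : Option V, A' x y ↔
      ((∃ a b : V, x = some a ∧ y = some b ∧ A a b ∧ ¬(a = uj ∧ b = v)) ∨
        (x = some uj ∧ y = none)))
    {c : V} {S : Finset V} (hv : v ∉ S) :
    GGWins A c S ↔ GGWins A' (some c) (S.image some) := by
  have harc : ∀ a b, A' (some a) (some b) ↔ A a b ∧ ¬(a = uj ∧ b = v) := by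
    simp [hA']
  have hnew : ∀ a, A' (some a) none ↔ a = uj := by simp [hA']
  have hsink_new : ∀ x, ¬ A' none x := by simp [hA']
  have hsink_old : ∀ x, ¬ A' (some v) x := by
    rintro (_ | x) h
    · exact hout v ((hnew v).1 h ▸ hujv)
    · exact hout x ((harc v x).1 h).1
  constructor
  · intro h
    induction h with
    | intro c S w hcw hw hreply ih =>
      by_cases hwv : w = v
      · subst hwv
        by_cases hc : c = uj
        · exact .of_adj_sink ((hnew c).2 hc) (by simp) hsink_new
        · exact .of_adj_sink ((harc c w).2 ⟨hcw, fun h => hc h.1⟩) (by simpa using hv)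
            hsink_old
      · have hv' : v ∉ insert w S := by simp [Ne.symm hwv, hv]
        have hne : ¬ A w v := fun hwA => (hreply v hwA hv').exists_adj.elim hout
        refine .intro _ _ (some w) ((harc c w).2 ⟨hcw, fun h => hwv h.2⟩)
          (by simpa using hw) ?_
        rintro (_ | x) hx hxS
        · exact absurd ((hnew w).1 hx ▸ hujv) hne
        · have hwx := ((harc w x).1 hx).1
          have hxv : v ≠ x := fun h => hne (h ▸ hwx)
          simpa only [Finset.image_insert] using
            ih x hwx (by simpa using hxS) (by simp [hxv, Ne.symm hwv, hv])
  · intro h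
    generalize hd : some c = d at h
    generalize hT : S.image some = T at h
    induction h generalizing c S with
    | intro d T w hdw hw hreply ih =>
      subst hd hT
      rcases w with _ | w
      · obtain rfl := (hnew c).1 hdw
        exact .of_adj_sink hujv hv hout
      · have hcw := ((harc c w).1 hdw).1
        by_cases hwv : w = v
        · exact .of_adj_sink (hwv ▸ hcw) hv hout
        · refine .intro c S w hcw (by simpa using hw) fun x hwx hxS => ?_
          have hxv : x ≠ v := by
            rintro rfl
            by_cases hwj : w = uj
            · exact (hreply none ((hnew w).2 hwj) (by simp)).exists_adj.elim hsink_new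
            · exact (hreply (some x) ((harc w x).2 ⟨hwx, fun h => hwj h.1⟩)
                (by simpa using hxS)).exists_adj.elim hsink_old
          exact ih (some x) ((harc w x).2 ⟨hwx, fun h => hxv h.2⟩) (by simpa using hxS)
            (by simp [Ne.symm hxv, Ne.symm hwv, hv]) rfl
            (by simp only [Finset.image_insert])

/-- Splitting a sink of indegree 2 preserves the winner: if `v ≠ s` has outdegree `0`
and exactly the two incoming arcs `(ui, v)` and `(uj, v)` with `ui ≠ uj`, and `G'`
(on vertex set `Option V`, the new vertex being `none`) is obtained from `G` by
replacing the arc `(uj, v)` with an arc from `uj` to the new vertex, then the first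
player wins on `(G, s)` iff the first player wins on `(G', s)`. -/
theorem split_indegree_two_sink_wins_iff {V : Type*} [Fintype V] [DecidableEq V]
    (A : V → V → Prop) (s v ui uj : V)
    (hvs : v ≠ s) (hout : ∀ w : V, ¬ A v w) (huij : ui ≠ uj)
    (hin : ∀ w : V, A w v ↔ (w = ui ∨ w = uj))
    (A' : Option V → Option V → Prop)
    (hA' : ∀ x y : Option V, A' x y ↔
      ((∃ a b : V, x = some a ∧ y = some b ∧ A a b ∧ ¬(a = uj ∧ b = v)) ∨
        (x = some uj ∧ y = none))) :
    GGFirstWins A s ↔ GGFirstWins A' (some s) := by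
  simpa [GGFirstWins] using
    ggWins_split_iff (c := s) (S := {s}) hout ((hin uj).2 (.inr rfl)) hA' (by simpa using hvs)
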